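/- (Theorem 1.2, type (1,2) indefinite theta identity) For τ ∈ ℍ and z₁, z₂, z₃ ∈ ℂ with 0 < Im(z₂), Im(z₃) < Im(τ) and z₁ ∉ ℤτ+ℤ, the indefinite theta series F(z₁,z₂,z₃;τ) = q^{-1/8} ζ₁^{-1/2} ζ₂^{1/2} ζ₃^{1/2} (∑_{k>0, ℓ,m≥0} + ∑_{k≤0, ℓ,m<0}) (-1)^k q^{k(k+1)/2 + kℓ + km + ℓm} ζ₁^k ζ₂^ℓ ζ₃^m equals i·ϑ(z₁;τ)·μ(z₁,z₂;τ)·μ(z₁,z₃;τ) - (η(τ)³·ϑ(z₂+z₃;τ)/(ϑ(z₂;τ)ϑ(z₃;τ)))·μ(z₁,z₂+z₃;τ). -/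

import Mathlib

/-- The Jacobi theta function ϑ(z;τ) = ∑_{n ∈ 1/2+ℤ} q^{n²/2} e^{2πi(z+1/2)n}. -/
noncomputable def jTheta (z τ : ℂ) : ℂ :=
  ∑' n : ℤ, Complex.exp (Real.pi * Complex.I * τ * ((n : ℂ) + 1 / 2) ^ 2) *
    Complex.exp (2 * Real.pi * Complex.I * (z + 1 / 2) * ((n : ℂ) + 1 / 2))

/-- The Dedekind eta function η(τ) = q^{1/24} ∏_{n≥1} (1 - qⁿ). -/
noncomputable def dedekindEta (τ : ℂ) : ℂ :=
  Complex.exp (Real.pi * Complex.I * τ / 12) *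
    ∏' n : ℕ, (1 - Complex.exp (2 * Real.pi * Complex.I * τ) ^ (n + 1))

/-- Zwegers' μ-function. -/
noncomputable def mu (z₁ z₂ τ : ℂ) : ℂ :=
  Complex.exp (Real.pi * Complex.I * z₁) / jTheta z₂ τ *
    ∑' n : ℤ, (-Complex.exp (2 * Real.pi * Complex.I * z₂)) ^ n *
        Complex.exp (Real.pi * Complex.I * τ * (n : ℂ) * ((n : ℂ) + 1)) /
      (1 - Complex.exp (2 * Real.pi * Complex.I * z₁) *
        Complex.exp (2 * Real.pi * Complex.I * τ) ^ n)

/-- `z` does not lie in the lattice ℤτ + ℤ. -/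
def NotLattice (z τ : ℂ) : Prop := ∀ m n : ℤ, z ≠ m * τ + n

/-- The summand (-1)^k q^{k(k+1)/2 + kℓ + km + ℓm} ζ₁^k ζ₂^ℓ ζ₃^m. -/
noncomputable def Fterm (z₁ z₂ z₃ τ : ℂ) (k l m : ℤ) : ℂ :=
  (-1 : ℂ) ^ k *
    Complex.exp (2 * Real.pi * Complex.I * τ) ^ (k * (k + 1) / 2 + k * l + k * m + l * m) *
    Complex.exp (2 * Real.pi * Complex.I * z₁) ^ k *
    Complex.exp (2 * Real.pi * Complex.I * z₂) ^ l *
    Complex.exp (2 * Real.pi * Complex.I * z₃) ^ m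

/-- The type (1,2) indefinite theta function F(z₁,z₂,z₃;τ). -/
noncomputable def F (z₁ z₂ z₃ τ : ℂ) : ℂ :=
  Complex.exp (-Real.pi * Complex.I * τ / 4) * Complex.exp (-Real.pi * Complex.I * z₁) *
    Complex.exp (Real.pi * Complex.I * z₂) * Complex.exp (Real.pi * Complex.I * z₃) *
    ((∑' p : ℕ × ℕ × ℕ, Fterm z₁ z₂ z₃ τ ((p.1 : ℤ) + 1) (p.2.1 : ℤ) (p.2.2 : ℤ))
      + ∑' p : ℕ × ℕ × ℕ,
          Fterm z₁ z₂ z₃ τ (-(p.1 : ℤ)) (-(p.2.1 : ℤ) - 1) (-(p.2.2 : ℤ) - 1))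

section Helpers

open Filter Topology


/-- The theta coefficients `(-1)^n q^{n(n-1)/2}`. -/
noncomputable def tt (q : ℂ) (n : ℤ) : ℂ := (-1 : ℂ) ^ n * q ^ (n * (n - 1) / 2)

theorem half_add (m a : ℤ) :
    (m + a) * (m + a - 1) / 2 = m * (m - 1) / 2 + a * (a - 1) / 2 + m * a := by
  obtain ⟨c, hc⟩ := Int.even_mul_pred_self m
  obtain ⟨d, hd⟩ := Int.even_mul_pred_self a
  have h : (m + a) * (m + a - 1) = (c + d + m * a) * 2 := by linear_combination hc + hd
  have h1 : m * (m - 1) = c * 2 := by linear_combination hc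
  have h2 : a * (a - 1) = d * 2 := by linear_combination hd
  rw [h, h1, h2]
  simp

theorem tt_add {q : ℂ} (hq : q ≠ 0) (m a : ℤ) :
    tt q (m + a) = tt q m * tt q a * q ^ (m * a) := by
  unfold tt
  rw [half_add, zpow_add₀ (by norm_num), zpow_add₀ hq, zpow_add₀ hq]
  ring

theorem tt_one (q : ℂ) : tt q 1 = -1 := by simp [tt]
theorem tt_zero (q : ℂ) : tt q 0 = 1 := by simp [tt]

theorem tt_succ {q : ℂ} (hq : q ≠ 0) (m : ℤ) : tt q (m + 1) = - tt q m * q ^ m := by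
  rw [tt_add hq, tt_one]; simp

theorem tt_ne {q : ℂ} (hq : q ≠ 0) (m : ℤ) : tt q m ≠ 0 := by
  unfold tt
  exact mul_ne_zero (zpow_ne_zero _ (by norm_num)) (zpow_ne_zero _ hq)

theorem tt_one_sub (q : ℂ) (m : ℤ) : tt q (1 - m) = - tt q m := by
  unfold tt
  have : (1 - m) * (1 - m - 1) = m * (m - 1) := by ring
  rw [this, zpow_sub₀ (by norm_num)]
  rcases Int.even_or_odd m with h | h
  · simp [h.neg_one_zpow]
  · simp [h.neg_one_zpow]

theorem tt_neg {q : ℂ} (hq : q ≠ 0) (m : ℤ) : tt q (-m) = tt q m * q ^ m := by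
  have h := tt_one_sub q (m + 1)
  rw [tt_succ hq] at h
  have : 1 - (m + 1) = -m := by ring
  rw [this] at h
  rw [h]; ring

/-- Rapidly decreasing sequences. -/
def Rapid (s : ℕ → ℂ) : Prop := ∀ r : ℝ, 0 < r → ∃ C : ℝ, ∀ n, ‖s n‖ * r ^ n ≤ C

theorem Rapid.shift {s : ℕ → ℂ} (h : Rapid s) (c : ℕ) : Rapid (fun n => s (n + c)) := by
  intro r hr
  obtain ⟨C, hC⟩ := h r hr
  refine ⟨C / r ^ c, fun n => ?_⟩
  rw [le_div_iff₀ (by positivity)]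
  have := hC (n + c)
  rw [pow_add] at this
  calc _ = _ := by ring
    _ ≤ _ := this

theorem Rapid.summable {s : ℕ → ℂ} (h : Rapid s) (x : ℂ) :
    Summable (fun n => s n * x ^ n) := by
  obtain ⟨C, hC⟩ := h (2 * (‖x‖ + 1)) (by positivity)
  refine Summable.of_norm_bounded (g := fun n : ℕ => C * (1 / 2 : ℝ) ^ n)
    (summable_geometric_two.mul_left C) (fun n => ?_)
  have h1 := hC n
  rw [mul_pow] at h1
  have h2 : ‖x‖ ^ n ≤ (‖x‖ + 1) ^ n := by gcongr; linarith
  rw [norm_mul, norm_pow]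
  have h3 : (2 : ℝ) ^ n * (1 / 2) ^ n = 1 := by rw [← mul_pow]; norm_num
  calc ‖s n‖ * ‖x‖ ^ n ≤ ‖s n‖ * (‖x‖ + 1) ^ n := by gcongr
    _ = (‖s n‖ * (2 ^ n * (‖x‖ + 1) ^ n)) * (1 / 2) ^ n := by
        linear_combination (-‖s n‖ * (‖x‖ + 1) ^ n) * h3
    _ ≤ _ := by gcongr

theorem Rapid.summable3 {s : ℕ → ℂ} (h : Rapid s) (x y w : ℂ) :
    Summable (fun p : ℕ × ℕ × ℕ =>
      s (p.1 + p.2.1 + p.2.2) * x ^ p.1 * y ^ p.2.1 * w ^ p.2.2) := by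
  obtain ⟨C, hC⟩ := h (2 * (‖x‖ + ‖y‖ + ‖w‖ + 1)) (by positivity)
  set M := ‖x‖ + ‖y‖ + ‖w‖ + 1 with hM
  have hx : ‖x‖ ≤ M := by have := norm_nonneg y; have := norm_nonneg w; linarith
  have hy : ‖y‖ ≤ M := by have := norm_nonneg x; have := norm_nonneg w; linarith
  have hw : ‖w‖ ≤ M := by have := norm_nonneg y; have := norm_nonneg x; linarith
  have hM0 : 0 < M := by positivity
  have g := summable_geometric_two
  have g2 := g.mul_of_nonneg g (fun _ => by positivity) (fun _ => by positivity)
  have g3 := g.mul_of_nonneg g2 (fun _ => by positivity) (fun _ => by positivity)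
  refine Summable.of_norm_bounded (g3.mul_left C) (fun p => ?_)
  obtain ⟨i, l, m⟩ := p
  simp only [norm_mul, norm_pow]
  have h1 := hC (i + l + m)
  have h3 : (2 : ℝ) ^ (i + l + m) * ((1 / 2) ^ i * ((1 / 2) ^ l * (1 / 2) ^ m)) = 1 := by
    rw [← pow_add, ← pow_add, ← add_assoc, ← mul_pow]; norm_num
  calc ‖s (i + l + m)‖ * ‖x‖ ^ i * ‖y‖ ^ l * ‖w‖ ^ m
      ≤ ‖s (i + l + m)‖ * M ^ i * M ^ l * M ^ m := by gcongr
    _ = (‖s (i + l + m)‖ * (2 * M) ^ (i + l + m)) *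
          ((1 / 2) ^ i * ((1 / 2) ^ l * (1 / 2) ^ m)) := by
        rw [mul_pow 2 M, pow_add M, pow_add M]
        linear_combination (-‖s (i + l + m)‖ * M ^ i * M ^ l * M ^ m) * h3
    _ ≤ _ := by gcongr

theorem Rapid.summable2 {s : ℕ → ℂ} (h : Rapid s) (x y : ℂ) :
    Summable (fun p : ℕ × ℕ => s (p.1 + p.2) * x ^ p.1 * y ^ p.2) := by
  have h3 := h.summable3 x y 0
  have : Function.Injective (fun p : ℕ × ℕ => ((p.1, p.2, 0) : ℕ × ℕ × ℕ)) := by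
    rintro ⟨a, b⟩ ⟨c, d⟩ h; simpa using h
  simpa [Function.comp_def] using h3.comp_injective this

theorem hasSum_antidiag {f : ℕ × ℕ → ℂ} {a : ℂ} (h : HasSum f a) :
    HasSum (fun n => ∑ p ∈ Finset.HasAntidiagonal.antidiagonal n, f p) a := by
  have h1 := (Finset.HasAntidiagonal.sigmaAntidiagonalEquivProd.hasSum_iff (f := f)).2 h
  refine h1.sigma (fun n => ?_)
  have := hasSum_fintype (fun c : Finset.HasAntidiagonal.antidiagonal n => f c)
  rw [Finset.sum_coe_sort (Finset.HasAntidiagonal.antidiagonal n) f] at this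
  exact this

theorem Rapid.diff {s : ℕ → ℂ} (h : Rapid s) (x y : ℂ) :
    (x - y) * ∑' p : ℕ × ℕ, s (p.1 + p.2 + 1) * x ^ p.1 * y ^ p.2
      = (∑' n, s n * x ^ n) - ∑' n, s n * y ^ n := by
  have h1 := (h.shift 1).summable2 x y
  have h2 := (hasSum_antidiag h1.hasSum).mul_left (x - y)
  rw [← h2.tsum_eq, ← (h.summable x).tsum_sub (h.summable y)]
  rw [((h.summable x).sub (h.summable y)).tsum_eq_zero_add]
  simp only [pow_zero, sub_self, zero_add]
  refine tsum_congr fun n => ?_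
  have : ∀ p ∈ Finset.HasAntidiagonal.antidiagonal n, s (p.1 + p.2 + 1) * x ^ p.1 * y ^ p.2
     = s (n + 1) * (x ^ p.1 * y ^ p.2) := by
    intro p hp
    rw [Finset.HasAntidiagonal.mem_antidiagonal] at hp
    rw [hp]; ring
  rw [Finset.sum_congr rfl this, ← Finset.mul_sum,
    Finset.Nat.sum_antidiagonal_eq_sum_range_succ (fun i j => x ^ i * y ^ j)]
  have := geom_sum₂_mul x y (n + 1)
  simp only [Nat.add_sub_cancel] at this
  linear_combination s (n + 1) * this

theorem Rapid.diag {s : ℕ → ℂ} (h : Rapid s) (y : ℂ) :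
    HasSum (fun n : ℕ => ((n : ℂ) + 1) * s n * y ^ n)
      (∑' p : ℕ × ℕ, s (p.1 + p.2) * y ^ p.1 * y ^ p.2) := by
  have h1 := h.summable2 y y
  have h2 := (hasSum_antidiag h1.hasSum)
  convert h2 using 1
  funext n
  have : ∀ p ∈ Finset.HasAntidiagonal.antidiagonal n, s (p.1 + p.2) * y ^ p.1 * y ^ p.2
     = s n * y ^ n := by
    intro p hp
    rw [Finset.HasAntidiagonal.mem_antidiagonal] at hp
    rw [hp, mul_assoc, ← pow_add, hp]
  rw [Finset.sum_congr rfl this]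
  simp; ring

theorem tt_rapid {q : ℂ} (hq : q ≠ 0) (hq1 : ‖q‖ < 1) : Rapid (fun n => tt q n) := by
  intro r hr
  have h : Summable (fun n : ℕ => ‖tt q n‖ * r ^ n) := by
    refine summable_of_ratio_test_tendsto_lt_one (l := 0) one_pos
      (Eventually.of_forall fun n => ?_) ?_
    · have := tt_ne hq n
      positivity
    · have h0 : Tendsto (fun n : ℕ => ‖q‖ ^ n * r) atTop (𝓝 0) := by
        simpa using (tendsto_pow_atTop_nhds_zero_of_lt_one (norm_nonneg q) hq1).mul_const r
      refine h0.congr fun n => ?_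
      have := norm_ne_zero_iff.2 (tt_ne hq n)
      push_cast
      rw [tt_succ hq]
      simp only [norm_mul, norm_neg, norm_norm, norm_pow, zpow_natCast,
        Real.norm_of_nonneg hr.le, pow_succ]
      field_simp
  obtain ⟨C, hC⟩ := (Metric.isBounded_range_of_tendsto _ h.tendsto_atTop_zero).bddAbove
  exact ⟨C, fun n => hC ⟨n, rfl⟩⟩

theorem tt_rapid_neg {q : ℂ} (hq : q ≠ 0) (hq1 : ‖q‖ < 1) :
    Rapid (fun n => tt q (-(n : ℤ))) := by
  intro r hr
  obtain ⟨C, hC⟩ := tt_rapid hq hq1 r hr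
  refine ⟨C, fun n => le_trans ?_ (hC n)⟩
  simp only [tt_neg hq]
  have : ‖q‖ ^ n ≤ 1 := pow_le_one₀ (norm_nonneg _) hq1.le
  simp only [norm_mul, zpow_natCast, norm_pow]
  gcongr
  exact mul_le_of_le_one_right (norm_nonneg _) this


theorem Rapid.unshift {s : ℕ → ℂ} (h : Rapid (fun n => s (n + 1))) : Rapid s := by
  intro r hr
  obtain ⟨C, hC⟩ := h r hr
  refine ⟨max ‖s 0‖ (r * C), fun n => ?_⟩
  rcases n with _ | n
  · simp
  · refine le_trans ?_ (le_max_right _ _)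
    have := mul_le_mul_of_nonneg_left (hC n) hr.le
    rw [pow_succ]
    linarith

theorem Rapid.diff3 {s : ℕ → ℂ} (h : Rapid s) (x y w : ℂ) :
    (x - y) * ∑' p : ℕ × ℕ × ℕ, s (p.1 + p.2.1 + p.2.2 + 1) * x ^ p.1 * y ^ p.2.1 * w ^ p.2.2
      = (∑' p : ℕ × ℕ, s (p.1 + p.2) * x ^ p.1 * w ^ p.2)
        - ∑' p : ℕ × ℕ, s (p.1 + p.2) * y ^ p.1 * w ^ p.2 := by
  have h1 := (h.shift 1).summable3 x y w
  let e : ℕ × (ℕ × ℕ) ≃ ℕ × ℕ × ℕ := (Equiv.prodComm _ _).trans (Equiv.prodAssoc ℕ ℕ ℕ)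
  have h2 := (e.summable_iff).2 h1
  have hx := ((Equiv.prodComm ℕ ℕ).summable_iff).2 (h.summable2 x w)
  have hy := ((Equiv.prodComm ℕ ℕ).summable_iff).2 (h.summable2 y w)
  rw [← e.tsum_eq, ← (Equiv.prodComm ℕ ℕ).tsum_eq (fun p : ℕ × ℕ => s (p.1 + p.2) * x ^ p.1 * w ^ p.2),
    ← (Equiv.prodComm ℕ ℕ).tsum_eq (fun p : ℕ × ℕ => s (p.1 + p.2) * y ^ p.1 * w ^ p.2)]
  simp only [Function.comp_def] at hx hy h2
  rw [← hx.tsum_sub hy]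
  have h2' := h2.tsum_prod
  have hxy := (hx.sub hy).tsum_prod
  rw [h2', hxy, ← tsum_mul_left]
  refine tsum_congr fun m => ?_
  have h5 := (h.shift m).diff x y
  simp only [e, Equiv.trans_apply, Equiv.prodComm_apply, Prod.swap, Equiv.prodAssoc_apply]
  rw [tsum_mul_right, (((h.shift m).summable x).mul_right _).tsum_sub
    (((h.shift m).summable y).mul_right _), tsum_mul_right, tsum_mul_right, ← sub_mul, ← h5]
  rw [mul_assoc]
  congr 3
  funext p
  have : p.1 + p.2 + m + 1 = p.1 + p.2 + 1 + m := by ring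
  rw [this]

theorem Rapid.peel {s : ℕ → ℂ} (h : Rapid s) (x w : ℂ) :
    ∑' p : ℕ × ℕ, s (p.1 + p.2) * x ^ p.1 * w ^ p.2
      = (∑' m, s m * w ^ m) + x * ∑' p : ℕ × ℕ, s (p.1 + p.2 + 1) * x ^ p.1 * w ^ p.2 := by
  have h1 := h.summable2 x w
  have h2 := (h.shift 1).summable2 x w
  rw [h1.tsum_prod, h2.tsum_prod, ← tsum_mul_left, h1.prod.tsum_eq_zero_add]
  simp only [zero_add, pow_zero, mul_one]
  congr 1
  refine tsum_congr fun n => ?_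
  rw [← tsum_mul_left]
  refine tsum_congr fun m => ?_
  have : n + 1 + m = n + m + 1 := by ring
  rw [this, pow_succ]; ring

/-- The theta series in multiplicative form. -/
noncomputable def Th (q x : ℂ) : ℂ := ∑' n : ℤ, tt q n * x ^ n


theorem rap_neg {q : ℂ} (hq : q ≠ 0) (hq1 : ‖q‖ < 1) (c : ℕ) : Rapid (fun n => tt q (-((n : ℤ) + c))) := by
  have := (tt_rapid_neg hq hq1).shift c
  simpa using this

theorem rap_pos {q : ℂ} (hq : q ≠ 0) (hq1 : ‖q‖ < 1) (c : ℕ) : Rapid (fun n => tt q ((n : ℤ) + c)) := by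
  have := (tt_rapid hq hq1).shift c
  simpa using this

theorem rap_pred {q : ℂ} (hq : q ≠ 0) (hq1 : ‖q‖ < 1) : Rapid (fun n => tt q ((n : ℤ) - 1)) := by
  apply Rapid.unshift
  simpa using (tt_rapid hq hq1)

theorem Th_hasSum' {q : ℂ} (hq : q ≠ 0) (hq1 : ‖q‖ < 1) {x : ℂ} (hx : x ≠ 0) : HasSum (fun n : ℤ => tt q n * x ^ n)
    ((∑' n : ℕ, tt q n * x ^ n) + x⁻¹ * ∑' n : ℕ, tt q (-((n : ℤ) + 1)) * (x⁻¹) ^ n) := by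
  apply HasSum.of_nat_of_neg_add_one
  · simpa using ((tt_rapid hq hq1).summable x).hasSum
  · have := (((rap_neg hq hq1 1).summable x⁻¹).hasSum).mul_left x⁻¹
    simp only [Nat.cast_one] at this
    refine Eq.mp (congrArg (fun f => HasSum f _) (funext fun n => ?_)) this
    symm
    have : x ^ (-((n : ℤ) + 1)) = x⁻¹ * x⁻¹ ^ n := by
      rw [zpow_neg, zpow_add₀ hx]; simp [mul_comm]
    rw [this]; ring

theorem Th_summable {q : ℂ} (hq : q ≠ 0) (hq1 : ‖q‖ < 1) {x : ℂ} (hx : x ≠ 0) : Summable (fun n : ℤ => tt q n * x ^ n) :=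
  (Th_hasSum' hq hq1 hx).summable

theorem Th_eq {q : ℂ} (hq : q ≠ 0) (hq1 : ‖q‖ < 1) {x : ℂ} (hx : x ≠ 0) : x * Th q x =
    (∑' n : ℕ, tt q ((n : ℤ) - 1) * x ^ n) + (∑' n : ℕ, tt q (-((n : ℤ) + 1)) * (x⁻¹) ^ n)
      - tt q (-1) := by
  rw [Th, (Th_hasSum' hq hq1 hx).tsum_eq, ((rap_pred hq hq1).summable x).tsum_eq_zero_add]
  have : ∀ n : ℕ, tt q (((n + 1 : ℕ) : ℤ) - 1) * x ^ (n + 1) = x * (tt q n * x ^ n) := by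
    intro n
    push_cast
    rw [add_sub_cancel_right]; ring
  simp only [this]
  rw [tsum_mul_left]
  rw [mul_add, ← mul_assoc, mul_inv_cancel₀ hx]
  simp
  ring

/-- signed double sum -/
noncomputable def RR (q x w : ℂ) : ℂ :=
  (∑' p : ℕ × ℕ, tt q (p.1 + p.2) * x ^ p.1 * w ^ p.2)
   - x⁻¹ * w⁻¹ * ∑' p : ℕ × ℕ, tt q (-((p.1 : ℤ) + p.2 + 2)) * (x⁻¹) ^ p.1 * (w⁻¹) ^ p.2

noncomputable def PP (q x y w : ℂ) : ℂ :=
  ∑' p : ℕ × ℕ × ℕ, tt q ((p.1 : ℤ) + p.2.1 + p.2.2 + 1) * x ^ p.1 * y ^ p.2.1 * w ^ p.2.2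

noncomputable def QQ (q x y w : ℂ) : ℂ :=
  ∑' p : ℕ × ℕ × ℕ, tt q (-((p.1 : ℤ) + p.2.1 + p.2.2 + 2)) * x ^ p.1 * y ^ p.2.1 * w ^ p.2.2

theorem RR_eq {q : ℂ} (hq : q ≠ 0) (hq1 : ‖q‖ < 1) {x w : ℂ} (hx : x ≠ 0) (hw : w ≠ 0) :
    (x - w) * RR q x w = x * Th q x - w * Th q w := by
  rw [Th_eq hq hq1 hx, Th_eq hq hq1 hw, RR]
  have h1 := (rap_pred hq hq1).diff x w
  have h2 := (rap_neg hq hq1 1).diff x⁻¹ w⁻¹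
  push_cast at h1 h2
  simp only [add_sub_cancel_right] at h1
  simp only [add_assoc, one_add_one_eq_two] at h2 ⊢
  have h3 : (x - w) * (x⁻¹ * w⁻¹) = -(x⁻¹ - w⁻¹) := by field_simp; ring
  rw [mul_sub, ← mul_assoc (x - w) (x⁻¹ * w⁻¹), h3]
  linear_combination h1 + h2

theorem PQ_eq {q : ℂ} (hq : q ≠ 0) (hq1 : ‖q‖ < 1) {x y w : ℂ} (hx : x ≠ 0) (hy : y ≠ 0) (hw : w ≠ 0) :
    (x - y) * (x * PP q x y w + y⁻¹ * w⁻¹ * QQ q x⁻¹ y⁻¹ w⁻¹)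
      = x * (RR q x w - RR q y w) := by
  have h1 := (tt_rapid hq hq1).diff3 x y w
  have h2 := (rap_neg hq hq1 1).diff3 x⁻¹ y⁻¹ w⁻¹
  have h3 := (rap_neg hq hq1 1).peel x⁻¹ w⁻¹
  have h4 := (rap_neg hq hq1 1).peel y⁻¹ w⁻¹
  push_cast at h1 h2 h3 h4
  rw [h3, h4] at h2
  simp only [add_assoc, one_add_one_eq_two] at h1 h2
  simp only [PP, QQ, RR, add_assoc]
  have h5 : (x - y) * (y⁻¹ * w⁻¹) = - x * w⁻¹ * (x⁻¹ - y⁻¹) := by field_simp; ring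
  rw [mul_add, ← mul_assoc (x - y) (y⁻¹ * w⁻¹), h5]
  linear_combination x * h1 - x * w⁻¹ * h2

theorem RR_diag {q : ℂ} (hq : q ≠ 0) (hq1 : ‖q‖ < 1) {y : ℂ} (hy : y ≠ 0) :
    HasSum (fun n : ℤ => ((n : ℂ) + 1) * tt q n * y ^ n) (RR q y y) := by
  unfold RR
  rw [sub_eq_add_neg]
  apply HasSum.of_nat_of_neg_add_one
  · simpa using (tt_rapid hq hq1).diag y
  · have h := ((rap_neg hq hq1 2).diag y⁻¹).mul_left (-(y⁻¹ * y⁻¹))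
    rw [← hasSum_nat_add_iff' 1]
    simp only [Finset.range_one, Finset.sum_singleton]
    have e1 : ∀ A : ℂ, A - (((-(((0 : ℕ) : ℤ) + 1) : ℤ) : ℂ) + 1) * tt q (-(((0 : ℕ) : ℤ) + 1)) *
        y ^ (-(((0 : ℕ) : ℤ) + 1)) = A := by intro A; simp
    rw [e1, ← neg_mul]
    simp only [Nat.cast_add, Nat.cast_ofNat] at h
    refine Eq.mp (congrArg (fun f => HasSum f _) (funext fun n => ?_)) h
    symm
    · have : y ^ (-(((n + 1 : ℕ) : ℤ) + 1)) = y⁻¹ * y⁻¹ * y⁻¹ ^ n := by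
        have : (((n + 1 : ℕ) : ℤ) + 1) = ((n + 2 : ℕ) : ℤ) := by push_cast; ring
        rw [zpow_neg, this, zpow_natCast, pow_add]; simp [mul_comm]; ring
      rw [this]
      have : -(((n + 1 : ℕ) : ℤ) + 1) = -((n : ℤ) + 2) := by push_cast; ring
      rw [this]
      push_cast; ring

theorem Th_one (q : ℂ) : Th q 1 = 0 := by
  have h : Th q 1 = - Th q 1 := by
    conv_lhs => rw [Th, ← (Equiv.subLeft (1 : ℤ)).tsum_eq]
    rw [Th, ← tsum_neg]
    refine tsum_congr fun n => ?_
    simp [tt_one_sub]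
  linear_combination h / 2

theorem tt_shift_pow {q : ℂ} (hq : q ≠ 0) (m a : ℤ) :
    tt q (m + a) * (q ^ (-a)) ^ (m + a) = tt q m * (tt q a * q ^ (- (a * a))) := by
  rw [tt_add hq, ← zpow_mul, mul_assoc, mul_assoc, ← zpow_add₀ hq]
  congr 3
  ring

theorem Th_pow {q : ℂ} (hq : q ≠ 0) (hq1 : ‖q‖ < 1) (a : ℤ) : Th q (q ^ (-a)) = 0 := by
  rw [Th, ← (Equiv.addRight a).tsum_eq]
  simp only [Equiv.coe_addRight, tt_shift_pow hq]
  rw [tsum_mul_right]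
  have := Th_one q
  simp only [Th, one_zpow, mul_one] at this
  rw [this, zero_mul]

theorem RR_pow_ne {q : ℂ} (hq : q ≠ 0) (hq1 : ‖q‖ < 1) {a b : ℤ} (hab : q ^ (-a) ≠ q ^ (-b)) : RR q (q ^ (-a)) (q ^ (-b)) = 0 := by
  have := RR_eq hq hq1 (zpow_ne_zero (-a) hq) (zpow_ne_zero (-b) hq)
  rw [Th_pow hq hq1, Th_pow hq hq1] at this
  simp only [mul_zero, sub_zero, mul_eq_zero] at this
  exact this.resolve_left (sub_ne_zero.2 hab)

theorem RR_pow_eq {q : ℂ} (hq : q ≠ 0) (hq1 : ‖q‖ < 1) (a : ℤ) : RR q (q ^ (-a)) (q ^ (-a))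
     = tt q a * q ^ (- (a * a)) * ∑' n : ℤ, (n : ℂ) * tt q n := by
  have h := RR_diag hq hq1 (zpow_ne_zero (-a) hq)
  have h0 := Th_pow hq hq1 a
  have hs := Th_summable hq hq1 (zpow_ne_zero (-a) hq)
  have h1 := h.sub (HasSum.mul_left (a₁ := (0 : ℂ)) ((a : ℂ) + 1) (by rw [← h0]; exact hs.hasSum))
  rw [mul_zero, sub_zero] at h1
  rw [← (Equiv.addRight a).hasSum_iff] at h1
  rw [← h1.tsum_eq, ← tsum_mul_left]
  refine tsum_congr fun n => ?_
  have := tt_shift_pow hq n a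
  simp only [Function.comp, Equiv.coe_addRight]
  push_cast
  linear_combination n * this



/-- finite Euler product -/
noncomputable def pc (q : ℂ) (n : ℕ) : ℂ := ∏ i ∈ Finset.range n, (1 - q ^ (i + 1))

/-- Euler function -/
noncomputable def phi (q : ℂ) : ℂ := ∏' n : ℕ, (1 - q ^ (n + 1))

theorem pc_succ (q : ℂ) (n : ℕ) : pc q (n + 1) = pc q n * (1 - q ^ (n + 1)) := by
  simp [pc, Finset.prod_range_succ]

theorem one_sub_pow_ne {q : ℂ} (hq1 : ‖q‖ < 1) (n : ℕ) : 1 - q ^ (n + 1) ≠ 0 := by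
  rw [sub_ne_zero]
  intro h
  have h1 : ‖q‖ ^ (n + 1) = 1 := by rw [← norm_pow, ← h]; simp
  have h2 : ‖q‖ ^ (n + 1) < 1 := pow_lt_one₀ (norm_nonneg _) hq1 (by omega)
  linarith

theorem pc_ne {q : ℂ} (hq1 : ‖q‖ < 1) (n : ℕ) : pc q n ≠ 0 :=
  Finset.prod_ne_zero_iff.2 fun i _ => one_sub_pow_ne hq1 i

theorem mult_geom {q : ℂ} (hq1 : ‖q‖ < 1) (c : ℂ) :
    Multipliable (fun n : ℕ => 1 - c * q ^ n) := by
  have := multipliable_one_add_of_summable (f := fun n : ℕ => -(c * q ^ n)) (by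
    simpa using (summable_geometric_of_lt_one (norm_nonneg _) hq1).mul_left ‖c‖)
  simpa [sub_eq_add_neg] using this

theorem tprod_geom_ne {q : ℂ} (hq1 : ‖q‖ < 1) (c : ℂ) (h : ∀ n : ℕ, 1 - c * q ^ n ≠ 0) :
    ∏' n : ℕ, (1 - c * q ^ n) ≠ 0 := by
  have := tprod_one_add_ne_zero_of_summable (f := fun n : ℕ => -(c * q ^ n))
    (by simpa [sub_eq_add_neg] using h) (by
    simpa using (summable_geometric_of_lt_one (norm_nonneg _) hq1).mul_left ‖c‖)
  simpa [sub_eq_add_neg] using this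

theorem phi_eq (q : ℂ) : phi q = ∏' n : ℕ, (1 - q * q ^ n) := by
  simp [phi, pow_succ']

theorem phi_ne {q : ℂ} (hq1 : ‖q‖ < 1) : phi q ≠ 0 := by
  rw [phi_eq]
  apply tprod_geom_ne hq1
  intro n
  rw [← pow_succ']
  exact one_sub_pow_ne hq1 n

theorem pc_tendsto {q : ℂ} (hq1 : ‖q‖ < 1) : Tendsto (pc q) atTop (𝓝 (phi q)) := by
  have := (mult_geom hq1 q).tendsto_prod_tprod_nat
  rw [← phi_eq] at this
  refine this.congr fun n => ?_
  simp [pc, pow_succ']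

/-- q-binomial -/
noncomputable def qb (q : ℂ) (N k : ℕ) : ℂ :=
  if k ≤ N then pc q N / (pc q k * pc q (N - k)) else 0

theorem qb_zero {q : ℂ} (hq1 : ‖q‖ < 1) (N : ℕ) : qb q N 0 = 1 := by
  have h := pc_ne hq1 N
  have h0 : pc q 0 = 1 := by simp [pc]
  simp [qb, h0, h]

theorem qb_self {q : ℂ} (hq1 : ‖q‖ < 1) (N : ℕ) : qb q N N = 1 := by
  have h := pc_ne hq1 N
  have h0 : pc q 0 = 1 := by simp [pc]
  simp [qb, h0, h]

theorem qb_pascal {q : ℂ} (hq1 : ‖q‖ < 1) (N k : ℕ) (h : k ≤ N) :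
    qb q (N + 1) (k + 1) = qb q N (k + 1) + q ^ (N - k) * qb q N k := by
  rcases h.eq_or_lt with rfl | h
  · rw [qb_self hq1, qb_self hq1, qb, if_neg (by omega)]
    simp
  · obtain ⟨d, rfl⟩ := Nat.exists_eq_add_of_lt h
    rw [qb, qb, qb, if_pos (by omega), if_pos (by omega), if_pos (by omega)]
    have e1 : k + d + 1 + 1 - (k + 1) = d + 1 := by omega
    have e2 : k + d + 1 - (k + 1) = d := by omega
    have e3 : k + d + 1 - k = d + 1 := by omega
    rw [e1, e2, e3, pc_succ q (k + d + 1), pc_succ q k, pc_succ q d]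
    have h1 := pc_ne hq1 k
    have h2 := pc_ne hq1 d
    have h3 := one_sub_pow_ne hq1 k
    have h4 := one_sub_pow_ne hq1 d
    field_simp
    ring

theorem qbinom {q : ℂ} (hq : q ≠ 0) (hq1 : ‖q‖ < 1) (x : ℂ) (N : ℕ) :
    ∏ i ∈ Finset.range N, (1 - x * q ^ i)
      = ∑ k ∈ Finset.range (N + 1), tt q k * qb q N k * x ^ k := by
  induction N with
  | zero => simp [qb_zero hq1, tt_zero]
  | succ N ih =>
    rw [Finset.prod_range_succ, ih, Finset.sum_range_succ' _ (N + 1)]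
    have h1 : ∀ k ∈ Finset.range (N + 1), tt q ((k + 1 : ℕ) : ℤ) * qb q (N + 1) (k + 1) * x ^ (k + 1)
        = tt q ((k + 1 : ℕ) : ℤ) * qb q N (k + 1) * x ^ (k + 1)
          - (tt q k * qb q N k * x ^ k) * (x * q ^ N) := by
      intro k hk
      have hk : k ≤ N := by simpa [Nat.lt_succ_iff] using hk
      rw [qb_pascal hq1 N k hk]
      obtain ⟨d, rfl⟩ := Nat.exists_eq_add_of_le hk
      push_cast
      rw [tt_succ hq, Nat.add_sub_cancel_left, zpow_natCast]
      ring
    rw [Finset.sum_congr rfl h1, Finset.sum_sub_distrib, ← Finset.sum_mul, Finset.sum_range_succ (fun k : ℕ =>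
      tt q ((k + 1 : ℕ) : ℤ) * qb q N (k + 1) * x ^ (k + 1)) N]
    have h2 : qb q N (N + 1) = 0 := by rw [qb, if_neg (by omega)]
    have h3 := Finset.sum_range_succ' (fun k : ℕ => tt q k * qb q N k * x ^ k) N
    rw [h2]
    simp only [qb_zero hq1] at h3 ⊢
    rw [mul_sub, mul_one]
    linear_combination h3

theorem half_prod {q : ℂ} (hq : q ≠ 0) {x : ℂ} (hx : x ≠ 0) (n : ℕ) :
    ∏ i ∈ Finset.range n, (1 - x * q ^ (-(n : ℤ)) * q ^ i)
      = tt q n * q ^ (-((n : ℤ) * n)) * x ^ n * ∏ i ∈ Finset.range n, (1 - x⁻¹ * q ^ (i + 1)) := by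
  induction n with
  | zero => simp [tt_zero]
  | succ n ih =>
    rw [Finset.prod_range_succ']
    have h1 : ∀ i ∈ Finset.range n, 1 - x * q ^ (-((n + 1 : ℕ) : ℤ)) * q ^ (i + 1)
        = 1 - x * q ^ (-(n : ℤ)) * q ^ i := by
      intro i _
      push_cast
      rw [neg_add, zpow_add₀ hq, pow_succ]
      have : q ^ (-1 : ℤ) * q = 1 := by simp [hq]
      linear_combination (-x * q ^ (-(n : ℤ)) * q ^ i) * this
    rw [Finset.prod_congr rfl h1, ih, Finset.prod_range_succ]
    push_cast
    rw [tt_succ hq]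
    have e : -(((n : ℤ) + 1) * (n + 1)) = -((n : ℤ) * n) + (-(n : ℤ) + -((n : ℤ) + 1)) := by ring
    rw [e, zpow_add₀ hq (-((n : ℤ) * n)), zpow_add₀ hq (-(n : ℤ))]
    have h2 : q ^ (n : ℤ) * q ^ (-(n : ℤ)) = 1 := by rw [← zpow_add₀ hq]; simp
    have h3 : q ^ (-((n : ℤ) + 1)) * q ^ (n + 1) = 1 := by
      rw [← zpow_natCast q (n + 1), ← zpow_add₀ hq]; simp
    have h4 : x * x⁻¹ = 1 := mul_inv_cancel₀ hx
    set A := q ^ (-((n : ℤ) + 1))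
    set B := q ^ (-(n : ℤ))
    set C := q ^ (n : ℤ)
    set D := q ^ (n + 1)
    set P := ∏ i ∈ Finset.range n, (1 - x⁻¹ * q ^ (i + 1))
    simp only [pow_zero, mul_one]
    have e2 : 1 - x * A = -(C * B) * (x * A) * (1 - x⁻¹ * D) := by
      rw [h2]; linear_combination (-h3) - (A * D) * h4
    rw [e2, pow_succ]
    ring

theorem fin_jacobi {q : ℂ} (hq : q ≠ 0) (hq1 : ‖q‖ < 1) {x : ℂ} (hx : x ≠ 0) (n : ℕ) :
    (∏ i ∈ Finset.range n, (1 - x * q ^ i)) * ∏ i ∈ Finset.range n, (1 - x⁻¹ * q ^ (i + 1))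
      = ∑ k ∈ Finset.range (2 * n + 1),
          qb q (2 * n) k * (tt q ((k : ℤ) - n) * x ^ ((k : ℤ) - n)) := by
  have h := qbinom hq hq1 (x * q ^ (-(n : ℤ))) (2 * n)
  rw [two_mul n, Finset.prod_range_add, half_prod hq hx] at h
  have h1 : ∀ i ∈ Finset.range n, 1 - x * q ^ (-(n : ℤ)) * q ^ (n + i) = 1 - x * q ^ i := by
    intro i _
    have : q ^ (-(n : ℤ)) * q ^ n = 1 := by
      rw [← zpow_natCast q n, ← zpow_add₀ hq]; simp
    rw [pow_add]
    linear_combination (-x * q ^ i) * this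
  rw [Finset.prod_congr rfl h1] at h
  have h2 : ∀ k ∈ Finset.range (n + n + 1), tt q k * qb q (n + n) k * (x * q ^ (-(n : ℤ))) ^ k
      = (tt q n * q ^ (-((n : ℤ) * n)) * x ^ n) *
        (qb q (n + n) k * (tt q ((k : ℤ) - n) * x ^ ((k : ℤ) - n))) := by
    intro k _
    have := tt_shift_pow hq ((k : ℤ) - n) n
    rw [sub_add_cancel, zpow_natCast] at this
    rw [mul_pow]
    have e : x ^ n * x ^ ((k : ℤ) - n) = x ^ k := by
      rw [← zpow_natCast x n, ← zpow_add₀ hx]; simp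
    linear_combination (qb q (n + n) k * x ^ k) * this -
      qb q (n + n) k * tt q ((k : ℤ) - n) * (tt q n * q ^ (-((n : ℤ) * n))) * e
  rw [Finset.sum_congr rfl h2, ← Finset.mul_sum] at h
  have h3 : tt q n * q ^ (-((n : ℤ) * n)) * x ^ n ≠ 0 :=
    mul_ne_zero (mul_ne_zero (tt_ne hq _) (zpow_ne_zero _ hq)) (pow_ne_zero _ hx)
  apply mul_left_cancel₀ h3
  rw [two_mul n, ← h]
  ring

noncomputable def cc (q : ℂ) (n : ℕ) (j : ℤ) : ℂ :=
  if 0 ≤ (n : ℤ) + j then qb q (2 * n) ((n : ℤ) + j).toNat else 0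

theorem sum_cc (q : ℂ) (n : ℕ) (f : ℤ → ℂ) :
    ∑ k ∈ Finset.range (2 * n + 1), qb q (2 * n) k * f ((k : ℤ) - n) = ∑' j : ℤ, cc q n j * f j := by
  let e : ℕ ↪ ℤ := ⟨fun k => (k : ℤ) - n, fun a b h => by simpa using h⟩
  rw [tsum_eq_sum (s := (Finset.range (2 * n + 1)).map e), Finset.sum_map]
  · refine Finset.sum_congr rfl fun k _ => ?_
    have : (n : ℤ) + ((k : ℤ) - n) = k := by ring
    change _ = cc q n ((k : ℤ) - n) * f ((k : ℤ) - n)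
    simp [cc, this]
  · intro j hj
    rw [cc]
    split_ifs with h
    · have : qb q (2 * n) ((n : ℤ) + j).toNat = 0 := by
        rw [qb, if_neg]
        intro hle
        apply hj
        rw [Finset.mem_map]
        refine ⟨((n : ℤ) + j).toNat, by rw [Finset.mem_range]; omega, ?_⟩
        change ((((n : ℤ) + j).toNat : ℕ) : ℤ) - n = j
        omega
      rw [this, zero_mul]
    · simp

theorem cc_bound {q : ℂ} (hq1 : ‖q‖ < 1) : ∃ C : ℝ, ∀ n j, ‖cc q n j‖ ≤ C := by
  obtain ⟨A, hA⟩ := (Metric.isBounded_range_of_tendsto _ (pc_tendsto hq1).norm).bddAbove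
  obtain ⟨B, hB⟩ := (Metric.isBounded_range_of_tendsto _
    ((pc_tendsto hq1).inv₀ (phi_ne hq1)).norm).bddAbove
  have hA' : ∀ n, ‖pc q n‖ ≤ A := fun n => hA ⟨n, rfl⟩
  have hB' : ∀ n, ‖(pc q n)⁻¹‖ ≤ B := fun n => hB ⟨n, rfl⟩
  have hA0 : 0 ≤ A := (norm_nonneg _).trans (hA' 0)
  have hB0 : 0 ≤ B := (norm_nonneg _).trans (hB' 0)
  refine ⟨A * (B * B), fun n j => ?_⟩
  rw [cc, qb]
  split_ifs
  · rw [div_eq_mul_inv, mul_inv, norm_mul, norm_mul]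
    gcongr
    exacts [hA' _, hB' _, hB' _]
  · simp; positivity
  · simp; positivity

theorem cc_tendsto {q : ℂ} (hq1 : ‖q‖ < 1) (j : ℤ) :
    Tendsto (fun n => cc q n j) atTop (𝓝 (phi q)⁻¹) := by
  have t1 : Tendsto (fun n : ℕ => 2 * n) atTop atTop :=
    tendsto_atTop_atTop.2 fun b => ⟨b, fun a h => by omega⟩
  have t2 : Tendsto (fun n : ℕ => ((n : ℤ) + j).toNat) atTop atTop :=
    tendsto_atTop_atTop.2 fun b => ⟨b + j.natAbs, fun a h => by omega⟩
  have t3 : Tendsto (fun n : ℕ => 2 * n - ((n : ℤ) + j).toNat) atTop atTop :=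
    tendsto_atTop_atTop.2 fun b => ⟨b + j.natAbs, fun a h => by omega⟩
  have hp := pc_tendsto hq1
  have h0 := phi_ne hq1
  have := (hp.comp t1).div ((hp.comp t2).mul (hp.comp t3)) (mul_ne_zero h0 h0)
  have e : phi q / (phi q * phi q) = (phi q)⁻¹ := by field_simp
  rw [e] at this
  refine this.congr' ?_
  filter_upwards [eventually_ge_atTop j.natAbs] with n hn
  rw [cc, if_pos (by omega), qb, if_pos (by omega)]
  rfl

theorem cc_lim {q : ℂ} (hq1 : ‖q‖ < 1) (f : ℤ → ℂ) (hf : Summable f) :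
    Tendsto (fun n => ∑' j : ℤ, cc q n j * f j) atTop (𝓝 ((phi q)⁻¹ * ∑' j, f j)) := by
  obtain ⟨C, hC⟩ := cc_bound hq1
  rw [← tsum_mul_left]
  refine tendsto_tsum_of_dominated_convergence (bound := fun j => C * ‖f j‖)
    (hf.norm.mul_left C) (fun j => (cc_tendsto hq1 j).mul_const _)
    (Eventually.of_forall fun n j => ?_)
  rw [norm_mul]
  gcongr
  exact hC n j

/-- Jacobi triple product. -/
theorem triple {q : ℂ} (hq : q ≠ 0) (hq1 : ‖q‖ < 1) {x : ℂ} (hx : x ≠ 0) :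
    (∏' n : ℕ, (1 - x * q ^ n)) * (∏' n : ℕ, (1 - (x⁻¹ * q) * q ^ n)) = (phi q)⁻¹ * Th q x := by
  have h1 := cc_lim hq1 _ (Th_summable hq hq1 hx)
  have h2 := (mult_geom hq1 x).tendsto_prod_tprod_nat.mul
    (mult_geom hq1 (x⁻¹ * q)).tendsto_prod_tprod_nat
  refine tendsto_nhds_unique h2 (h1.congr fun n => ?_)
  rw [← sum_cc q n (fun j => tt q j * x ^ j), ← fin_jacobi hq hq1 hx]
  congr 1
  refine Finset.prod_congr rfl fun i _ => ?_
  ring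

theorem Th_ne {q : ℂ} (hq : q ≠ 0) (hq1 : ‖q‖ < 1) {x : ℂ} (hx : x ≠ 0)
    (h : ∀ n : ℤ, x ≠ q ^ n) : Th q x ≠ 0 := by
  intro h0
  have := triple hq hq1 hx
  rw [h0, mul_zero] at this
  rcases mul_eq_zero.1 this with h1 | h1
  · refine tprod_geom_ne hq1 _ (fun n hn => h (-n) ?_) h1
    rw [zpow_neg, zpow_natCast]
    exact eq_inv_of_mul_eq_one_left (sub_eq_zero.1 hn).symm
  · refine tprod_geom_ne hq1 _ (fun n hn => h (n + 1 : ℕ) ?_) h1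
    rw [zpow_natCast, pow_succ']
    have h2 := (sub_eq_zero.1 hn)
    field_simp at h2
    exact h2

theorem jacobi_summable {q : ℂ} (hq : q ≠ 0) (hq1 : ‖q‖ < 1) :
    Summable (fun n : ℤ => (n : ℂ) * tt q n) := by
  have h1 := (RR_diag hq hq1 one_ne_zero).summable
  have h2 := Th_summable hq hq1 one_ne_zero
  refine (h1.sub h2).congr fun n => ?_
  simp; ring

/-- Jacobi's identity for the cube of the Euler product. -/
theorem jacobi_cube {q : ℂ} (hq : q ≠ 0) (hq1 : ‖q‖ < 1) :
    ∑' n : ℤ, (n : ℂ) * tt q n = - phi q ^ 3 := by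
  have key : ∀ m : ℕ, ∑' j : ℤ, cc q (m + 1) j * ((j : ℂ) * tt q j) = -(pc q m * pc q (m + 1)) := by
    intro m
    rw [← sum_cc q (m + 1) (fun j => (j : ℂ) * tt q j)]
    let g : ℂ → ℂ := fun x => (∏ i ∈ Finset.range m, (1 - x * q ^ (i + 1))) *
      ∏ i ∈ Finset.range (m + 1), (1 - x⁻¹ * q ^ (i + 1))
    have hg : DifferentiableAt ℂ g 1 := by
      refine DifferentiableAt.mul ?_ ?_
      · refine DifferentiableAt.fun_finsetProd fun i _ => ?_
        fun_prop
      · refine DifferentiableAt.fun_finsetProd fun i _ => ?_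
        have : (1 : ℂ) ≠ 0 := one_ne_zero
        fun_prop (disch := assumption)
    have h1 : HasDerivAt (fun x : ℂ => (1 - x) * g x) ((-1) * g 1 + (1 - 1) * deriv g 1) 1 :=
      ((hasDerivAt_id (1 : ℂ)).const_sub 1).mul hg.hasDerivAt
    have h2 : HasDerivAt (fun x : ℂ => ∑ k ∈ Finset.range (2 * (m + 1) + 1),
          qb q (2 * (m + 1)) k * (tt q ((k : ℤ) - (m + 1 : ℕ)) * x ^ ((k : ℤ) - (m + 1 : ℕ))))
        (∑ k ∈ Finset.range (2 * (m + 1) + 1),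
          qb q (2 * (m + 1)) k * (tt q ((k : ℤ) - (m + 1 : ℕ)) *
            ((((k : ℤ) - (m + 1 : ℕ) : ℤ) : ℂ) * 1 ^ ((k : ℤ) - (m + 1 : ℕ) - 1)))) 1 := by
      refine HasDerivAt.fun_sum fun k _ => ?_
      exact ((hasDerivAt_zpow _ (1 : ℂ) (Or.inl one_ne_zero)).const_mul _).const_mul _
    have h3 : (fun x : ℂ => ∑ k ∈ Finset.range (2 * (m + 1) + 1),
          qb q (2 * (m + 1)) k * (tt q ((k : ℤ) - (m + 1 : ℕ)) * x ^ ((k : ℤ) - (m + 1 : ℕ))))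
        =ᶠ[𝓝 1] (fun x : ℂ => (1 - x) * g x) := by
      filter_upwards [isOpen_ne.mem_nhds (one_ne_zero : (1 : ℂ) ≠ 0)] with x hx
      rw [← fin_jacobi hq hq1 hx, Finset.prod_range_succ' _ m]
      simp only [g, pow_zero, mul_one]
      ring
    have h4 := h2.unique (h1.congr_of_eventuallyEq h3)
    have h5 : (-1) * g 1 + (1 - 1) * deriv g 1 = -(pc q m * pc q (m + 1)) := by
      simp [g, pc]
    rw [h5] at h4
    rw [← h4]
    refine Finset.sum_congr rfl fun k _ => ?_
    rw [one_zpow]; ring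
  have l1 := (cc_lim hq1 _ (jacobi_summable hq hq1)).comp (tendsto_add_atTop_nat 1)
  have l2 := ((pc_tendsto hq1).mul ((pc_tendsto hq1).comp (tendsto_add_atTop_nat 1))).neg
  have := tendsto_nhds_unique l1 (l2.congr fun m => (key m).symm)
  have h0 := phi_ne hq1
  field_simp at this
  linear_combination this


/-- summand of the indefinite theta series, multiplicative form -/
noncomputable def ft (q ζ₁ ζ₂ ζ₃ : ℂ) (k l m : ℤ) : ℂ :=
  (-1 : ℂ) ^ k * q ^ (k * (k + 1) / 2 + k * l + k * m + l * m) * ζ₁ ^ k * ζ₂ ^ l * ζ₃ ^ m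

theorem tt_mul_pow {q : ℂ} (hq : q ≠ 0) (ζ : ℂ) (k : ℤ) :
    tt q k * (q * ζ) ^ k = (-1 : ℂ) ^ k * q ^ (k * (k + 1) / 2) * ζ ^ k := by
  have e : k * (k + 1) / 2 = k * (k - 1) / 2 + k := by
    have : k * (k + 1) = k * (k - 1) + k * 2 := by ring
    rw [this, Int.add_mul_ediv_right _ _ (by norm_num)]
  rw [tt, mul_zpow, e, zpow_add₀ hq]; ring

theorem ft_eq {q : ℂ} (hq : q ≠ 0) (ζ₁ ζ₂ ζ₃ : ℂ) (k l m : ℤ) :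
    ft q ζ₁ ζ₂ ζ₃ k l m
      = tt q k * (q * ζ₁) ^ k * q ^ (k * l + k * m + l * m) * ζ₂ ^ l * ζ₃ ^ m := by
  rw [tt_mul_pow hq, ft, add_assoc, add_assoc, zpow_add₀ hq, ← add_assoc]
  ring

theorem ft_key {q ζ₂ ζ₃ : ℂ} (hq : q ≠ 0) (h2 : ζ₂ ≠ 0) (h3 : ζ₃ ≠ 0) (ζ₁ : ℂ) (a b k l m : ℤ) :
    (tt q (a - l) * (q * ζ₂) ^ (a - l)) * (tt q (b - m) * (q * ζ₃) ^ (b - m)) * ft q ζ₁ ζ₂ ζ₃ k l m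
     = (tt q a * (q * ζ₂) ^ a) * (tt q b * (q * ζ₃) ^ b) *
        (tt q (k + l + m) * (q * ζ₁) ^ k * (q ^ (-a)) ^ l * (q ^ (-b)) ^ m) := by
  have A1 : ∀ (ζ : ℂ) (a l : ℤ), ζ ≠ 0 → tt q (a - l) * (q * ζ) ^ (a - l) * ζ ^ l
      = tt q a * (q * ζ) ^ a * (tt q l * (q ^ (-a)) ^ l) := by
    intro ζ a l hζ
    rw [sub_eq_add_neg, tt_add hq, tt_neg hq, zpow_add₀ (mul_ne_zero hq hζ), zpow_neg (q * ζ),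
      mul_zpow q ζ l, ← zpow_mul]
    have e : a * -l = -a * l := by ring
    rw [e]
    have := zpow_ne_zero l hq
    have := zpow_ne_zero l hζ
    field_simp
  have h2' := A1 ζ₂ a l h2
  have h3' := A1 ζ₃ b m h3
  rw [ft_eq hq, tt_add hq, tt_add hq]
  have e : q ^ (k * l + k * m + l * m) = q ^ (k * l) * q ^ ((k + l) * m) := by
    rw [← zpow_add₀ hq]; congr 1; ring
  rw [e]
  calc _ = tt q k * (q * ζ₁) ^ k * (q ^ (k * l) * q ^ ((k + l) * m)) *
        (tt q (a - l) * (q * ζ₂) ^ (a - l) * ζ₂ ^ l) * (tt q (b - m) * (q * ζ₃) ^ (b - m) * ζ₃ ^ m) := by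
        ring
    _ = _ := by rw [h2', h3']; ring

theorem assembly {q ζ₂ ζ₃ : ℂ} (hq : q ≠ 0) (hq1 : ‖q‖ < 1) (h2 : ζ₂ ≠ 0) (h3 : ζ₃ ≠ 0) (ζ₁ : ℂ)
    (k l m : ℕ × ℕ × ℕ → ℤ) (hs : Summable (fun p => ft q ζ₁ ζ₂ ζ₃ (k p) (l p) (m p))) :
    HasSum (fun ab : ℤ × ℤ => (tt q ab.1 * (q * ζ₂) ^ ab.1) * (tt q ab.2 * (q * ζ₃) ^ ab.2) *
      ∑' p, tt q (k p + l p + m p) * (q * ζ₁) ^ (k p) * (q ^ (-ab.1)) ^ (l p) * (q ^ (-ab.2)) ^ (m p))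
      (Th q (q * ζ₂) * Th q (q * ζ₃) * ∑' p, ft q ζ₁ ζ₂ ζ₃ (k p) (l p) (m p)) := by
  have s2 := Th_summable hq hq1 (mul_ne_zero hq h2)
  have s3 := Th_summable hq hq1 (mul_ne_zero hq h3)
  have s23 := summable_mul_of_summable_norm s2.norm s3.norm
  have e23 := s2.tsum_mul_tsum s3 s23
  have sA := summable_mul_of_summable_norm s23.norm hs.norm
  have eA := s23.tsum_mul_tsum hs sA
  rw [Th, Th, e23, eA]
  let e : (ℤ × ℤ) × (ℕ × ℕ × ℕ) ≃ (ℤ × ℤ) × (ℕ × ℕ × ℕ) :=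
    { toFun := fun x => ((x.1.1 - l x.2, x.1.2 - m x.2), x.2)
      invFun := fun x => ((x.1.1 + l x.2, x.1.2 + m x.2), x.2)
      left_inv := by rintro ⟨⟨a, b⟩, p⟩; simp
      right_inv := by rintro ⟨⟨a, b⟩, p⟩; simp }
  have H := (e.hasSum_iff).2 sA.hasSum
  refine H.prod_fiberwise fun ab => ?_
  have hsum := H.summable.prod_factor ab
  have heq : ∀ p, (tt q (ab.1 - l p) * (q * ζ₂) ^ (ab.1 - l p)) *
      (tt q (ab.2 - m p) * (q * ζ₃) ^ (ab.2 - m p)) * ft q ζ₁ ζ₂ ζ₃ (k p) (l p) (m p) = _ :=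
    fun p => ft_key hq h2 h3 ζ₁ ab.1 ab.2 (k p) (l p) (m p)
  have := hsum.hasSum
  simp only [Function.comp_def, e, Equiv.coe_fn_mk, heq] at this ⊢
  rw [tsum_mul_left] at this
  exact this

theorem ft_pos_summable {q ζ₁ ζ₂ ζ₃ : ℂ} (hq : q ≠ 0) (hq1 : ‖q‖ < 1)
    (h1 : ζ₁ ≠ 0) (h2 : ‖ζ₂‖ < 1) (h3 : ‖ζ₃‖ < 1) :
    Summable (fun p : ℕ × ℕ × ℕ => ft q ζ₁ ζ₂ ζ₃ ((p.1 : ℤ) + 1) (p.2.1 : ℤ) (p.2.2 : ℤ)) := by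
  have s1 : Summable (fun i : ℕ => ‖tt q ((i : ℤ) + 1) * (q * ζ₁) ^ ((i : ℤ) + 1)‖) := by
    have := (Th_summable hq hq1 (mul_ne_zero hq h1)).norm
    exact this.comp_injective (i := fun i : ℕ => (i : ℤ) + 1) (fun a b h => by simpa using h)
  have g2 := summable_geometric_of_lt_one (norm_nonneg _) h2
  have g3 := summable_geometric_of_lt_one (norm_nonneg _) h3
  have g23 := g2.mul_of_nonneg g3 (fun _ => by positivity) (fun _ => by positivity)
  have g := s1.mul_of_nonneg g23 (fun _ => by positivity) (fun _ => by positivity)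
  refine Summable.of_norm_bounded g fun p => ?_
  obtain ⟨i, l, m⟩ := p
  have e : ((i : ℤ) + 1) * l + ((i : ℤ) + 1) * m + l * m
    = (((i + 1) * l + (i + 1) * m + l * m : ℕ) : ℤ) := by push_cast; ring
  simp only [ft_eq hq, e, zpow_natCast]
  rw [norm_mul, norm_mul, norm_mul, norm_pow, norm_pow, norm_pow, mul_assoc]
  gcongr
  exact mul_le_of_le_one_right (norm_nonneg _) (pow_le_one₀ (norm_nonneg _) hq1.le)

theorem ft_neg_summable {q ζ₁ ζ₂ ζ₃ : ℂ} (hq : q ≠ 0) (hq1 : ‖q‖ < 1)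
    (h1 : ζ₁ ≠ 0) (h2 : ‖q‖ < ‖ζ₂‖) (h3 : ‖q‖ < ‖ζ₃‖) :
    Summable (fun p : ℕ × ℕ × ℕ =>
      ft q ζ₁ ζ₂ ζ₃ (-(p.1 : ℤ)) (-(p.2.1 : ℤ) - 1) (-(p.2.2 : ℤ) - 1)) := by
  have s1 : Summable (fun i : ℕ => ‖tt q (-(i : ℤ)) * (q * ζ₁) ^ (-(i : ℤ))‖) := by
    have := (Th_summable hq hq1 (mul_ne_zero hq h1)).norm
    exact this.comp_injective (i := fun i : ℕ => -(i : ℤ)) (fun a b h => by simpa using h)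
  have n2 : 0 < ‖ζ₂‖ := (norm_nonneg _).trans_lt h2
  have n3 : 0 < ‖ζ₃‖ := (norm_nonneg _).trans_lt h3
  have z2 : ζ₂ ≠ 0 := norm_pos_iff.1 n2
  have z3 : ζ₃ ≠ 0 := norm_pos_iff.1 n3
  have g2 := summable_geometric_of_lt_one (norm_nonneg (q / ζ₂))
    (by rw [norm_div]; exact (div_lt_one n2).2 h2)
  have g3 := summable_geometric_of_lt_one (norm_nonneg (q / ζ₃))
    (by rw [norm_div]; exact (div_lt_one n3).2 h3)
  have g23 := g2.mul_of_nonneg g3 (fun _ => by positivity) (fun _ => by positivity)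
  have g := s1.mul_of_nonneg g23 (fun _ => by positivity) (fun _ => by positivity)
  refine Summable.of_norm_bounded (g.mul_left ‖q / (ζ₂ * ζ₃)‖) fun p => ?_
  obtain ⟨i, l, m⟩ := p
  have e : -(i : ℤ) * (-(l : ℤ) - 1) + -(i : ℤ) * (-(m : ℤ) - 1) + (-(l : ℤ) - 1) * (-(m : ℤ) - 1)
    = ((i * (l + 1) + i * (m + 1) + l * m + l + m + 1 : ℕ) : ℤ) := by push_cast; ring
  have f : ∀ (ζ : ℂ) (l : ℕ), ζ ≠ 0 → ζ ^ (-(l : ℤ) - 1) = (ζ ^ l)⁻¹ * ζ⁻¹ := by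
    intro ζ l h
    rw [zpow_sub₀ h, zpow_neg, zpow_natCast, zpow_one, div_eq_mul_inv]
  simp only [ft_eq hq, e, zpow_natCast, f _ _ z2, f _ _ z3]
  have e2 : tt q (-(i : ℤ)) * (q * ζ₁) ^ (-(i : ℤ)) *
      q ^ (i * (l + 1) + i * (m + 1) + l * m + l + m + 1) * ((ζ₂ ^ l)⁻¹ * ζ₂⁻¹) * ((ζ₃ ^ m)⁻¹ * ζ₃⁻¹)
     = q ^ (i * (l + 1) + i * (m + 1) + l * m) * (q / (ζ₂ * ζ₃) *
       ((tt q (-(i : ℤ)) * (q * ζ₁) ^ (-(i : ℤ))) * ((q / ζ₂) ^ l * (q / ζ₃) ^ m))) := by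
    rw [pow_add, pow_add, pow_add, div_pow, div_pow]
    field_simp
  rw [e2, norm_mul, norm_mul (q / (ζ₂ * ζ₃)), norm_mul (_ * _) (_ * _), norm_mul (_ ^ l), norm_pow, norm_pow, norm_pow]
  exact mul_le_of_le_one_left (by positivity) (pow_le_one₀ (norm_nonneg _) hq1.le)

theorem U_summable {q X Y : ℂ} (hq : q ≠ 0) (hq1 : ‖q‖ < 1) (hX : X ≠ 0) (hY : Y ≠ 0) :
    Summable (fun a : ℤ => tt q a * Y ^ a / (X - q ^ (-a))) := by
  have s := (Th_summable hq hq1 hY).norm.mul_right (2 / ‖X‖)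
  have hXp : 0 < ‖X‖ := norm_pos_iff.2 hX
  have hqp : 0 < ‖q‖ := norm_pos_iff.2 hq
  refine Summable.of_norm_bounded_eventually s ?_
  rw [Int.cofinite_eq, eventually_sup]
  have fin : ∀ a : ℤ, ‖X‖ / 2 ≤ ‖X - q ^ (-a)‖ →
      ‖tt q a * Y ^ a / (X - q ^ (-a))‖ ≤ ‖tt q a * Y ^ a‖ * (2 / ‖X‖) := by
    intro a ha
    rw [norm_div, div_eq_mul_inv]
    gcongr
    rw [← inv_div]
    exact inv_anti₀ (by positivity) ha
  have t0 := tendsto_pow_atTop_nhds_zero_of_lt_one (norm_nonneg q) hq1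
  constructor
  · obtain ⟨n, hn⟩ := (t0.eventually (gt_mem_nhds (half_pos hXp))).exists_forall_of_atTop
    filter_upwards [eventually_le_atBot (-(n : ℤ))] with a ha
    apply fin
    obtain ⟨b, hb⟩ : ∃ b : ℕ, -a = b := ⟨(-a).toNat, by omega⟩
    rw [hb, zpow_natCast]
    have h1 := hn b (by omega)
    have h2 := norm_sub_norm_le X (q ^ b)
    rw [norm_pow] at h2
    linarith
  · have t1 := t0.eventually (gt_mem_nhds (show (0 : ℝ) < 1 / (2 * ‖X‖) by positivity))
    obtain ⟨n, hn⟩ := t1.exists_forall_of_atTop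
    filter_upwards [eventually_ge_atTop (n : ℤ)] with a ha
    apply fin
    obtain ⟨b, hb⟩ : ∃ b : ℕ, a = b := ⟨a.toNat, by omega⟩
    rw [hb, zpow_neg, zpow_natCast]
    have h1 := hn b (by omega)
    have h2 := norm_sub_norm_le ((q ^ b)⁻¹) X
    rw [norm_sub_rev, norm_inv, norm_pow] at h2
    have h3 : 2 * ‖X‖ ≤ (‖q‖ ^ b)⁻¹ := by
      rw [le_inv_comm₀ (by positivity) (by positivity)]
      simpa using h1.le
    linarith

theorem main_mul {q ζ₁ ζ₂ ζ₃ : ℂ} (hq : q ≠ 0) (hq1 : ‖q‖ < 1)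
    (h1 : ζ₁ ≠ 0) (h2 : ‖q‖ < ‖ζ₂‖) (h2' : ‖ζ₂‖ < 1) (h3 : ‖q‖ < ‖ζ₃‖) (h3' : ‖ζ₃‖ < 1)
    (hX : ∀ a : ℤ, q * ζ₁ ≠ q ^ (-a)) :
    Th q (q * ζ₂) * Th q (q * ζ₃) *
      ((∑' p : ℕ × ℕ × ℕ, ft q ζ₁ ζ₂ ζ₃ ((p.1 : ℤ) + 1) (p.2.1 : ℤ) (p.2.2 : ℤ)) +
        ∑' p : ℕ × ℕ × ℕ,
          ft q ζ₁ ζ₂ ζ₃ (-(p.1 : ℤ)) (-(p.2.1 : ℤ) - 1) (-(p.2.2 : ℤ) - 1))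
     = (q * ζ₁) ^ 2 * Th q (q * ζ₁) * (∑' a : ℤ, tt q a * (q * ζ₂) ^ a / (q * ζ₁ - q ^ (-a)))
          * (∑' a : ℤ, tt q a * (q * ζ₃) ^ a / (q * ζ₁ - q ^ (-a)))
       + (q * ζ₁) * phi q ^ 3 * ∑' a : ℤ, tt q a * (q * (ζ₂ * ζ₃)) ^ a / (q * ζ₁ - q ^ (-a)) := by
  have z2 : ζ₂ ≠ 0 := norm_pos_iff.1 ((norm_nonneg _).trans_lt h2)
  have z3 : ζ₃ ≠ 0 := norm_pos_iff.1 ((norm_nonneg _).trans_lt h3)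
  have hqp : 0 < ‖q‖ := norm_pos_iff.2 hq
  have A1 := assembly hq hq1 z2 z3 ζ₁ _ _ _ (ft_pos_summable hq hq1 h1 h2' h3')
  have A2 := assembly hq hq1 z2 z3 ζ₁ _ _ _ (ft_neg_summable hq hq1 h1 h2 h3)
  have A := A1.add A2
  rw [← mul_add] at A
  set X := q * ζ₁ with hXdef
  have hX0 : X ≠ 0 := mul_ne_zero hq h1
  have s2 := U_summable hq hq1 hX0 (mul_ne_zero hq z2)
  have s3 := U_summable hq hq1 hX0 (mul_ne_zero hq z3)
  have s4 := U_summable hq hq1 hX0 (mul_ne_zero hq (mul_ne_zero z2 z3))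
  have s23 := summable_mul_of_summable_norm s2.norm s3.norm
  have B1 := s23.hasSum.mul_left (X ^ 2 * Th q X)
  rw [← s2.tsum_mul_tsum s3 s23] at B1
  have B2 := s4.hasSum.mul_left (X * phi q ^ 3)
  have inj : Function.Injective (fun a : ℤ => (a, a)) := fun a b h => by simpa using h
  let f : ℤ × ℤ → ℂ := fun ab => if ab.1 = ab.2 then
    X * phi q ^ 3 * (tt q ab.1 * (q * (ζ₂ * ζ₃)) ^ ab.1 / (X - q ^ (-ab.1))) else 0
  have B3 : HasSum f (X * phi q ^ 3 * ∑' a : ℤ, tt q a * (q * (ζ₂ * ζ₃)) ^ a / (X - q ^ (-a))) := (inj.hasSum_iff (f := f) (by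
    rintro ⟨a, b⟩ hab
    have : a ≠ b := by rintro rfl; exact hab ⟨a, rfl⟩
    simp [f, this])).1 (by
    simp only [Function.comp_def, f, if_true]
    exact B2)
  have B := B1.add B3
  rw [← mul_assoc] at B
  rw [← A.tsum_eq, ← B.tsum_eq]
  refine tsum_congr fun ab => ?_
  obtain ⟨a, b⟩ := ab
  have hy := zpow_ne_zero (-a) hq
  have hw := zpow_ne_zero (-b) hq
  have dy := sub_ne_zero.2 (hX a)
  have dw := sub_ne_zero.2 (hX b)
  have EP : (∑' p : ℕ × ℕ × ℕ, tt q ((p.1 : ℤ) + 1 + p.2.1 + p.2.2) * X ^ ((p.1 : ℤ) + 1) *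
      (q ^ (-a)) ^ (p.2.1 : ℤ) * (q ^ (-b)) ^ (p.2.2 : ℤ)) = X * PP q X (q ^ (-a)) (q ^ (-b)) := by
    rw [PP, ← tsum_mul_left]
    refine tsum_congr fun p => ?_
    have e : (p.1 : ℤ) + 1 + p.2.1 + p.2.2 = (p.1 : ℤ) + p.2.1 + p.2.2 + 1 := by ring
    rw [e, zpow_add₀ hX0, zpow_one, zpow_natCast, zpow_natCast, zpow_natCast]
    ring
  have EQ : (∑' p : ℕ × ℕ × ℕ, tt q (-(p.1 : ℤ) + (-(p.2.1 : ℤ) - 1) + (-(p.2.2 : ℤ) - 1)) *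
      X ^ (-(p.1 : ℤ)) * (q ^ (-a)) ^ (-(p.2.1 : ℤ) - 1) * (q ^ (-b)) ^ (-(p.2.2 : ℤ) - 1))
      = (q ^ (-a))⁻¹ * (q ^ (-b))⁻¹ * QQ q X⁻¹ (q ^ (-a))⁻¹ (q ^ (-b))⁻¹ := by
    rw [QQ, ← tsum_mul_left]
    refine tsum_congr fun p => ?_
    have e : -(p.1 : ℤ) + (-(p.2.1 : ℤ) - 1) + (-(p.2.2 : ℤ) - 1)
      = -((p.1 : ℤ) + p.2.1 + p.2.2 + 2) := by ring
    have f : ∀ (ζ : ℂ) (l : ℕ), ζ ≠ 0 → ζ ^ (-(l : ℤ) - 1) = (ζ⁻¹) ^ l * ζ⁻¹ := by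
      intro ζ l h
      rw [zpow_sub₀ h, zpow_neg, zpow_natCast, zpow_one, div_eq_mul_inv, inv_pow]
    rw [e, f _ _ hy, f _ _ hw, zpow_neg X, zpow_natCast, ← inv_pow]
    ring
  dsimp only
  rw [EP, EQ, ← mul_add]
  have K1 := PQ_eq hq hq1 hX0 hy hw
  have K2 := RR_eq hq hq1 hX0 hw
  rw [Th_pow hq hq1, mul_zero, sub_zero] at K2
  have K : X * PP q X (q ^ (-a)) (q ^ (-b)) +
      (q ^ (-a))⁻¹ * (q ^ (-b))⁻¹ * QQ q X⁻¹ (q ^ (-a))⁻¹ (q ^ (-b))⁻¹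
      = X ^ 2 * Th q X / ((X - q ^ (-a)) * (X - q ^ (-b)))
        - X * RR q (q ^ (-a)) (q ^ (-b)) / (X - q ^ (-a)) := by
    rw [eq_sub_iff_add_eq, eq_div_iff (mul_ne_zero dy dw)]
    have : X * RR q (q ^ (-a)) (q ^ (-b)) / (X - q ^ (-a)) * (X - q ^ (-a)) =
      X * RR q (q ^ (-a)) (q ^ (-b)) := div_mul_cancel₀ _ dy
    linear_combination (X - q ^ (-b)) * K1 + X * K2 + (X - q ^ (-b)) * this
  rw [K]
  by_cases hab : a = b
  · subst hab
    have L : tt q a * (tt q a * q ^ (-(a * a))) = q ^ (-a) := by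
      have h := tt_add hq a (-a)
      rw [add_neg_cancel, tt_zero, tt_neg hq, mul_neg] at h
      rw [zpow_neg q a]
      apply eq_inv_of_mul_eq_one_left
      linear_combination -h
    rw [RR_pow_eq hq hq1, jacobi_cube hq hq1]
    simp only [f, if_true]
    have e : (q * (ζ₂ * ζ₃)) ^ a = (q * ζ₂) ^ a * (q * ζ₃) ^ a * q ^ (-a) := by
      rw [zpow_neg, mul_zpow, mul_zpow, mul_zpow, mul_zpow]
      have := zpow_ne_zero a hq
      field_simp
    rw [e, ← L]
    field_simp
    ring
  · have hne : q ^ (-a) ≠ q ^ (-b) := by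
      intro h
      have h' : ‖q‖ ^ (-a) = ‖q‖ ^ (-b) := by rw [← norm_zpow, ← norm_zpow, h]
      have := zpow_right_injective₀ hqp hq1.ne h'
      exact hab (by simpa using this)
    rw [RR_pow_ne hq hq1 hne]
    simp only [f, hab, if_false]
    field_simp
    ring

/-- Shifted Appell sum -/
theorem U_eq {q ζ₁ : ℂ} (hq : q ≠ 0) {ζ : ℂ} (hζ : ζ ≠ 0) (hX : ∀ a : ℤ, q * ζ₁ ≠ q ^ (-a)) :
    ∑' a : ℤ, tt q a * (q * ζ) ^ a / (q * ζ₁ - q ^ (-a))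
      = (q * ζ)⁻¹ * ∑' a : ℤ, tt q a * (q * ζ) ^ a / (1 - ζ₁ * q ^ a) := by
  rw [← (Equiv.subRight (1 : ℤ)).tsum_eq, ← tsum_mul_left]
  refine tsum_congr fun a => ?_
  have h0 := hX (a - 1)
  simp only [Equiv.subRight_apply]
  have e1 : tt q a = - tt q (a - 1) * q ^ (a - 1) := by
    have := tt_succ hq (a - 1)
    rwa [sub_add_cancel] at this
  have e2 : q ^ a = q ^ (a - 1) * q := by rw [← zpow_add_one₀ hq]; simp
  have e3 : (q * ζ) ^ a = (q * ζ) ^ (a - 1) * (q * ζ) := by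
    rw [← zpow_add_one₀ (mul_ne_zero hq hζ)]; simp
  have hr := zpow_ne_zero (a - 1) hq
  rw [e1, e2, e3, zpow_neg] at *
  have h1 : q * ζ₁ - (q ^ (a - 1))⁻¹ = -(q ^ (a - 1))⁻¹ * (1 - ζ₁ * (q ^ (a - 1) * q)) := by
    field_simp; ring
  have h2 : 1 - ζ₁ * (q ^ (a - 1) * q) ≠ 0 := by
    intro h
    rw [h, mul_zero] at h1
    exact h0 (sub_eq_zero.1 h1)
  rw [h1]
  field_simp

theorem exp_half_sq (z : ℂ) : Complex.exp (2 * Real.pi * Complex.I * z)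
    = Complex.exp (Real.pi * Complex.I * z) ^ 2 := by
  rw [← Complex.exp_nat_mul]; congr 1; push_cast; ring

theorem tt_mul_pow_exp (z τ : ℂ) (n : ℤ) :
    tt (Complex.exp (2 * Real.pi * Complex.I * τ)) n *
      (Complex.exp (2 * Real.pi * Complex.I * τ) * Complex.exp (2 * Real.pi * Complex.I * z)) ^ n
    = (-Complex.exp (2 * Real.pi * Complex.I * z)) ^ n *
        Complex.exp (Real.pi * Complex.I * τ * (n : ℂ) * ((n : ℂ) + 1)) := by
  rw [tt_mul_pow (Complex.exp_ne_zero _)]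
  obtain ⟨c, hc⟩ := Int.even_mul_succ_self n
  have hc2 : n * (n + 1) / 2 = c := by omega
  have hcc : (n : ℂ) * ((n : ℂ) + 1) = 2 * c := by
    have : ((n * (n + 1) : ℤ) : ℂ) = ((c + c : ℤ) : ℂ) := by rw [hc]
    push_cast at this
    rw [this]; ring
  rw [hc2, ← Complex.exp_int_mul _ c, neg_eq_neg_one_mul (Complex.exp (2 * Real.pi * Complex.I * z)),
    mul_zpow]
  have : Real.pi * Complex.I * τ * (n : ℂ) * ((n : ℂ) + 1)
      = c * (2 * Real.pi * Complex.I * τ) := by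
    linear_combination Real.pi * Complex.I * τ * hcc
  rw [this]; ring

theorem jTheta_eq (z τ : ℂ) : jTheta z τ
    = Complex.I * Complex.exp (Real.pi * Complex.I * τ / 4) * Complex.exp (Real.pi * Complex.I * z)
      * Th (Complex.exp (2 * Real.pi * Complex.I * τ))
        (Complex.exp (2 * Real.pi * Complex.I * τ) * Complex.exp (2 * Real.pi * Complex.I * z)) := by
  rw [jTheta, Th, ← tsum_mul_left]
  refine tsum_congr fun n => ?_
  rw [tt_mul_pow_exp]
  have e1 : (-Complex.exp (2 * Real.pi * Complex.I * z)) ^ n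
      = Complex.exp (n * (Real.pi * Complex.I + 2 * Real.pi * Complex.I * z)) := by
    rw [Complex.exp_int_mul, Complex.exp_add, Complex.exp_pi_mul_I, neg_one_mul]
  have e2 : Complex.I = Complex.exp (Real.pi / 2 * Complex.I) := Complex.exp_pi_div_two_mul_I.symm
  rw [e1]
  conv_rhs => rw [show ∀ a b c d : ℂ, Complex.I * a * b * (c * d) =
    Complex.exp (Real.pi / 2 * Complex.I) * a * b * (c * d) from fun a b c d => by rw [← e2]]
  simp only [← Complex.exp_add]
  congr 1; ring

theorem mu_eq (u v τ : ℂ) : mu u v τ = Complex.exp (Real.pi * Complex.I * u) / jTheta v τ *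
    ∑' n : ℤ, tt (Complex.exp (2 * Real.pi * Complex.I * τ)) n *
      (Complex.exp (2 * Real.pi * Complex.I * τ) * Complex.exp (2 * Real.pi * Complex.I * v)) ^ n /
      (1 - Complex.exp (2 * Real.pi * Complex.I * u) *
        Complex.exp (2 * Real.pi * Complex.I * τ) ^ n) := by
  rw [mu]
  simp only [tt_mul_pow_exp]

theorem eta_cube (τ : ℂ) : dedekindEta τ ^ 3 = Complex.exp (Real.pi * Complex.I * τ / 4) *
    phi (Complex.exp (2 * Real.pi * Complex.I * τ)) ^ 3 := by
  rw [dedekindEta, mul_pow, ← Complex.exp_nat_mul, phi]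
  congr 2; push_cast; ring

theorem norm_e (z : ℂ) : ‖Complex.exp (2 * Real.pi * Complex.I * z)‖
    = Real.exp (-(2 * Real.pi * z.im)) := by
  rw [Complex.norm_exp]; congr 1; simp

theorem notLattice_ne {z τ : ℂ} (h : NotLattice z τ) (n : ℤ) :
    Complex.exp (2 * Real.pi * Complex.I * τ) * Complex.exp (2 * Real.pi * Complex.I * z)
      ≠ Complex.exp (2 * Real.pi * Complex.I * τ) ^ n := by
  intro h0
  rw [← Complex.exp_int_mul, ← Complex.exp_add, Complex.exp_eq_exp_iff_exists_int] at h0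
  obtain ⟨k, hk⟩ := h0
  apply h (n - 1) k
  have hp : (2 * Real.pi * Complex.I : ℂ) ≠ 0 := Complex.two_pi_I_ne_zero
  apply mul_left_cancel₀ hp
  push_cast
  linear_combination hk

theorem notLattice_of_im {z τ : ℂ} (h : 0 < z.im) (h' : z.im < τ.im) : NotLattice z τ := by
  intro m n e
  have e2 : z.im = m * τ.im := by rw [e]; simp
  have hτ : 0 < τ.im := h.trans h'
  have h1 : (0 : ℝ) < m := by
    by_contra! hm
    nlinarith
  have h2 : (m : ℝ) < 1 := by
    by_contra! hm
    nlinarith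
  have : 0 < m := by exact_mod_cast h1
  have : m < 1 := by exact_mod_cast h2
  omega

theorem jTheta_ne {z τ : ℂ} (hτ : 0 < τ.im) (h : NotLattice z τ) : jTheta z τ ≠ 0 := by
  rw [jTheta_eq]
  refine mul_ne_zero (mul_ne_zero (mul_ne_zero Complex.I_ne_zero (Complex.exp_ne_zero _))
    (Complex.exp_ne_zero _)) (Th_ne (Complex.exp_ne_zero _) ?_
      (mul_ne_zero (Complex.exp_ne_zero _) (Complex.exp_ne_zero _)) (notLattice_ne h))
  rw [norm_e, Real.exp_lt_one_iff]
  have := Real.pi_pos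
  have : 0 < Real.pi * τ.im := by positivity
  linarith


end Helpers

theorem stmt15 (τ z₁ z₂ z₃ : ℂ) (hτ : 0 < τ.im)
    (h₂ : 0 < z₂.im) (h₂' : z₂.im < τ.im) (h₃ : 0 < z₃.im) (h₃' : z₃.im < τ.im)
    (h₁ : NotLattice z₁ τ) (h₂₃ : NotLattice (z₂ + z₃) τ) :
    F z₁ z₂ z₃ τ
      = Complex.I * jTheta z₁ τ * mu z₁ z₂ τ * mu z₁ z₃ τ
        - dedekindEta τ ^ 3 * jTheta (z₂ + z₃) τ / (jTheta z₂ τ * jTheta z₃ τ) *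
            mu z₁ (z₂ + z₃) τ := by
  have hpi := Real.pi_pos
  have hlt : ∀ a b : ℂ, a.im < b.im → ‖Complex.exp (2 * Real.pi * Complex.I * b)‖
      < ‖Complex.exp (2 * Real.pi * Complex.I * a)‖ := by
    intro a b hab
    rw [norm_e, norm_e, Real.exp_lt_exp]
    nlinarith
  have hlt1 : ∀ b : ℂ, 0 < b.im → ‖Complex.exp (2 * Real.pi * Complex.I * b)‖ < 1 := by
    intro b hb
    have := hlt 0 b (by simpa using hb)
    simpa using this
  have hj2 := jTheta_ne hτ (notLattice_of_im h₂ h₂')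
  have hj3 := jTheta_ne hτ (notLattice_of_im h₃ h₃')
  have hj23 := jTheta_ne hτ h₂₃
  have hq : Complex.exp (2 * Real.pi * Complex.I * τ) ≠ 0 := Complex.exp_ne_zero _
  have hX : ∀ a : ℤ, Complex.exp (2 * Real.pi * Complex.I * τ) *
      Complex.exp (2 * Real.pi * Complex.I * z₁) ≠ Complex.exp (2 * Real.pi * Complex.I * τ) ^ (-a) :=
    fun a => notLattice_ne h₁ (-a)
  have M := main_mul hq (hlt1 τ hτ) (Complex.exp_ne_zero (2 * Real.pi * Complex.I * z₁))
    (hlt z₂ τ h₂') (hlt1 z₂ h₂) (hlt z₃ τ h₃') (hlt1 z₃ h₃) hX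
  rw [U_eq hq (Complex.exp_ne_zero _) hX, U_eq hq (Complex.exp_ne_zero _) hX,
    U_eq hq (mul_ne_zero (Complex.exp_ne_zero _) (Complex.exp_ne_zero _)) hX] at M
  have e23 : Complex.exp (2 * Real.pi * Complex.I * (z₂ + z₃)) =
      Complex.exp (2 * Real.pi * Complex.I * z₂) * Complex.exp (2 * Real.pi * Complex.I * z₃) := by
    rw [← Complex.exp_add]; congr 1; ring
  have f23 : Complex.exp (Real.pi * Complex.I * (z₂ + z₃)) =
      Complex.exp (Real.pi * Complex.I * z₂) * Complex.exp (Real.pi * Complex.I * z₃) := by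
    rw [← Complex.exp_add]; congr 1; ring
  have g1 : Complex.exp (-Real.pi * Complex.I * τ / 4)
      = (Complex.exp (Real.pi * Complex.I * τ / 4))⁻¹ := by
    rw [← Complex.exp_neg]; congr 1; ring
  have g2 : Complex.exp (-Real.pi * Complex.I * z₁)
      = (Complex.exp (Real.pi * Complex.I * z₁))⁻¹ := by
    rw [← Complex.exp_neg]; congr 1; ring
  have hF : ∀ k l m : ℤ, Fterm z₁ z₂ z₃ τ k l m = ft (Complex.exp (2 * Real.pi * Complex.I * τ))
    (Complex.exp (2 * Real.pi * Complex.I * z₁)) (Complex.exp (2 * Real.pi * Complex.I * z₂))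
    (Complex.exp (2 * Real.pi * Complex.I * z₃)) k l m := fun k l m => rfl
  rw [F, mu_eq, mu_eq, mu_eq, eta_cube, g1, g2]
  simp only [hF]
  rw [jTheta_eq] at hj2 hj3 hj23
  rw [jTheta_eq z₁, jTheta_eq z₂, jTheta_eq z₃, jTheta_eq (z₂ + z₃)]
  rw [e23, f23] at hj23 ⊢
  have s1 := exp_half_sq z₁
  have s2 := exp_half_sq z₂
  have s3 := exp_half_sq z₃
  have n1 := Complex.exp_ne_zero (Real.pi * Complex.I * z₁)
  have n2 := Complex.exp_ne_zero (Real.pi * Complex.I * z₂)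
  have n3 := Complex.exp_ne_zero (Real.pi * Complex.I * z₃)
  have nt := Complex.exp_ne_zero (Real.pi * Complex.I * τ / 4)
  generalize (∑' p : ℕ × ℕ × ℕ, ft _ _ _ _ ((p.1 : ℤ) + 1) (p.2.1 : ℤ) (p.2.2 : ℤ)) +
        ∑' p : ℕ × ℕ × ℕ, ft _ _ _ _ (-(p.1 : ℤ)) (-(p.2.1 : ℤ) - 1) (-(p.2.2 : ℤ) - 1) = G at *
  generalize (∑' a : ℤ, tt _ a * (_ * Complex.exp (2 * Real.pi * Complex.I * z₂)) ^ a / (1 - _)) = S2 at *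
  generalize (∑' a : ℤ, tt _ a * (_ * Complex.exp (2 * Real.pi * Complex.I * z₃)) ^ a / (1 - _)) = S3 at *
  generalize (∑' a : ℤ, tt _ a * (_ * (_ * _)) ^ a / (1 - _)) = S23 at *
  generalize Th _ (_ * Complex.exp (2 * Real.pi * Complex.I * z₁)) = T1 at *
  generalize Th _ (_ * Complex.exp (2 * Real.pi * Complex.I * z₂)) = T2 at *
  generalize Th _ (_ * Complex.exp (2 * Real.pi * Complex.I * z₃)) = T3 at *
  generalize Th _ (_ * (_ * _)) = T23 at *
  generalize phi _ = P at *
  rw [s1, s2, s3] at M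
  generalize Complex.exp (Real.pi * Complex.I * z₁) = x1 at *
  generalize Complex.exp (Real.pi * Complex.I * z₂) = x2 at *
  generalize Complex.exp (Real.pi * Complex.I * z₃) = x3 at *
  generalize Complex.exp (Real.pi * Complex.I * τ / 4) = t at *
  generalize Complex.exp (2 * Real.pi * Complex.I * τ) = q at *
  have k2 : T2 ≠ 0 := right_ne_zero_of_mul hj2
  have k3 : T3 ≠ 0 := right_ne_zero_of_mul hj3
  have k23 : T23 ≠ 0 := right_ne_zero_of_mul hj23
  clear hj2 hj3 hj23 hX hlt hlt1 hF s1 s2 s3 e23 f23 g1 g2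
  have hG : G = (x1 ^ 4 * T1 * S2 * S3 / (x2 ^ 2 * x3 ^ 2) + x1 ^ 2 * P ^ 3 * S23 / (x2 ^ 2 * x3 ^ 2))
      / (T2 * T3) := by
    rw [eq_div_iff (mul_ne_zero k2 k3), mul_comm, M]
    field_simp
  rw [hG]
  have hI := Complex.I_ne_zero
  have hI2 := Complex.I_sq
  generalize Complex.I = i at *
  field_simp
  linear_combination P ^ 3 * S23 * hI2
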